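/- arXiv:2208.04923 — 3 statements merged into one kernel-verified Lean document; each statement's English description precedes it below -/
import Mathlib

section
/- Let n = 2, α ∈ (0,1] and B > 0. Let ψ : ℝ² → ℝ be continuous and ℤ²-periodic with ψ ≤ 0 on ℝ², ψ(0) = 0, and ψ(x) ≥ −B|x|^α for all |x| ≤ 1/2. Then there exists a constant C > 0 depending only on α and B such that for every μ ∈ (0,1] and every continuous ℤ²-periodic function v : ℝ² → ℝ satisfying v ≥ ψ on ℝ² and Δv ≤ μ weakly in ℝ², one has v(x) ≥ −C μ (1 + |log μ|) for all x ∈ ℝ². In particular, the height 𝓔(μ) of the minimal such supersolution satisfies 𝓔(μ) ≤ C μ (1 + |log μ|). -/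
open MeasureTheory Metric Set

/-- The (pointwise) Laplacian of a smooth `f : ℝⁿ → ℝ`. -/
noncomputable def lapl (n : ℕ) (f : EuclideanSpace ℝ (Fin n) → ℝ)
    (x : EuclideanSpace ℝ (Fin n)) : ℝ :=
  ∑ i : Fin n, fderiv ℝ (fun y => fderiv ℝ f y (EuclideanSpace.single i 1)) x
    (EuclideanSpace.single i 1)

/-- `f : ℝⁿ → ℝ` is `ℤⁿ`-periodic. -/
def IsZnPeriodic (n : ℕ) (f : EuclideanSpace ℝ (Fin n) → ℝ) : Prop :=
  ∀ (x : EuclideanSpace ℝ (Fin n)) (k : Fin n → ℤ),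
    f (x + (WithLp.equiv 2 (Fin n → ℝ)).symm (fun i => (k i : ℝ))) = f x

/-- `Δw ≤ c` weakly in `V`: `∫_V w Δφ ≤ c ∫_V φ` for every nonnegative smooth
compactly supported `φ` with support in `V`. -/
def LapLeWeak (n : ℕ) (V : Set (EuclideanSpace ℝ (Fin n)))
    (w : EuclideanSpace ℝ (Fin n) → ℝ) (c : ℝ) : Prop :=
  ∀ φ : EuclideanSpace ℝ (Fin n) → ℝ, ContDiff ℝ (⊤ : ℕ∞) φ → HasCompactSupport φ →
    tsupport φ ⊆ V → (∀ x, 0 ≤ φ x) →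
    ∫ x in V, w x * lapl n φ x ≤ c * ∫ x in V, φ x

open Filter Topology ContinuousLinearMap
open scoped Convolution

/-- At a local minimum, the second derivative is nonnegative. -/
lemma IsLocalMin.second_deriv_nonneg {f f' : ℝ → ℝ} {a c : ℝ} (hmin : IsLocalMin f a)
    (hf : ∀ᶠ t in 𝓝 a, HasDerivAt f (f' t) t) (hf' : HasDerivAt f' c a) : 0 ≤ c := by
  by_contra! hc
  have hderiv : deriv f =ᶠ[𝓝 a] f' := hf.mono fun t ht => ht.deriv
  have hdd : deriv (deriv f) a = c := by rw [hderiv.deriv_eq, hf'.deriv]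
  have hmax : IsLocalMax f a := isLocalMax_of_deriv_deriv_neg (by rw [hdd]; exact hc)
    hmin.deriv_eq_zero hf.self_of_nhds.continuousAt
  have hconst : f =ᶠ[𝓝 a] fun _ => f a := by
    filter_upwards [hmin, hmax] with t h1 h2 using le_antisymm h2 h1
  have hzero : deriv f =ᶠ[𝓝 a] fun _ => 0 := by simpa using hconst.deriv
  rw [hzero.deriv_eq] at hdd
  simp at hdd
  exact hc.ne hdd.symm

section Mollification

variable {n : ℕ} {v ρ : EuclideanSpace ℝ (Fin n) → ℝ}

lemma fderiv_convolution_mul_apply (hv : Continuous v) (hρ : ContDiff ℝ (⊤ : ℕ∞) ρ)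
    (hs : HasCompactSupport ρ) (x e : EuclideanSpace ℝ (Fin n)) :
    fderiv ℝ (v ⋆[mul ℝ ℝ, volume] ρ) x e =
      (v ⋆[mul ℝ ℝ, volume] fun y => fderiv ℝ ρ y e) x := by
  have h1 : ContDiff ℝ 1 ρ := hρ.of_le (by exact_mod_cast le_top)
  rw [(hs.hasFDerivAt_convolution_right (mul ℝ ℝ) hv.locallyIntegrable h1 x).fderiv,
    convolution_precompR_apply _ hv.locallyIntegrable (hs.fderiv ℝ)
      (h1.continuous_fderiv one_ne_zero)]

lemma lapl_convolution_mul (hv : Continuous v) (hρ : ContDiff ℝ (⊤ : ℕ∞) ρ)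
    (hs : HasCompactSupport ρ) (x : EuclideanSpace ℝ (Fin n)) :
    lapl n (v ⋆[mul ℝ ℝ, volume] ρ) x = ∫ y, v y * lapl n ρ (x - y) := by
  have hD (e : EuclideanSpace ℝ (Fin n)) {σ : EuclideanSpace ℝ (Fin n) → ℝ}
      (hσ : ContDiff ℝ (⊤ : ℕ∞) σ) : ContDiff ℝ (⊤ : ℕ∞) fun y => fderiv ℝ σ y e :=
    (hσ.fderiv_right (m := (⊤ : ℕ∞)) (by norm_cast)).clm_apply contDiff_const
  have hS (e : EuclideanSpace ℝ (Fin n)) {σ : EuclideanSpace ℝ (Fin n) → ℝ}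
      (hσ : HasCompactSupport σ) : HasCompactSupport fun y => fderiv ℝ σ y e :=
    hσ.fderiv_apply ℝ e
  have key (e : EuclideanSpace ℝ (Fin n)) :
      fderiv ℝ (fun y => fderiv ℝ (v ⋆[mul ℝ ℝ, volume] ρ) y e) x e =
        ∫ y, v y * fderiv ℝ (fun z => fderiv ℝ ρ z e) (x - y) e := by
    simp_rw [fderiv_convolution_mul_apply hv hρ hs]
    exact fderiv_convolution_mul_apply hv (hD e hρ) (hS e hs) x e
  simp only [lapl, key, Finset.mul_sum]
  rw [integral_finsetSum]
  intro i _
  exact (hS _ (hS _ hs)).convolutionExists_right (mul ℝ ℝ) hv.locallyIntegrable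
    (hD _ (hD _ hρ)).continuous x

lemma fderiv_comp_const_sub_apply {f : EuclideanSpace ℝ (Fin n) → ℝ} (hf : Differentiable ℝ f)
    (x y e : EuclideanSpace ℝ (Fin n)) :
    fderiv ℝ (fun z => f (x - z)) y e = -fderiv ℝ f (x - y) e := by
  have h := (hf (x - y)).hasFDerivAt.comp y ((hasFDerivAt_id y).const_sub x)
  have h2 := h.fderiv
  simp only [Function.comp_def] at h2
  rw [h2]
  simp

lemma lapl_comp_const_sub (hρ : ContDiff ℝ (⊤ : ℕ∞) ρ) (x y : EuclideanSpace ℝ (Fin n)) :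
    lapl n (fun z => ρ (x - z)) y = lapl n ρ (x - y) := by
  have hD (e : EuclideanSpace ℝ (Fin n)) : Differentiable ℝ fun y => fderiv ℝ ρ y e :=
    ((hρ.fderiv_right (m := (⊤ : ℕ∞)) (by norm_cast)).clm_apply contDiff_const).differentiable
      (by simp)
  simp only [lapl, fderiv_comp_const_sub_apply (hρ.differentiable (by simp)), fderiv_fun_neg,
    neg_apply, fderiv_comp_const_sub_apply (hD _), neg_neg]

lemma LapLeWeak.lapl_convolution_le {c : ℝ} (hw : LapLeWeak n univ v c) (hv : Continuous v)
    (hρ : ContDiff ℝ (⊤ : ℕ∞) ρ) (hs : HasCompactSupport ρ) (h0 : ∀ x, 0 ≤ ρ x)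
    (h1 : ∫ x, ρ x = 1) (x : EuclideanSpace ℝ (Fin n)) :
    lapl n (v ⋆[mul ℝ ℝ, volume] ρ) x ≤ c := by
  have h := hw (fun y => ρ (x - y)) (hρ.comp (contDiff_const.sub contDiff_id))
    (hs.comp_homeomorph (Homeomorph.subLeft x)) (subset_univ _) fun y => h0 _
  simp only [Measure.restrict_univ, lapl_comp_const_sub hρ] at h
  rw [integral_sub_left_eq_self ρ volume x, h1, mul_one] at h
  rwa [lapl_convolution_mul hv hρ hs]

lemma IsZnPeriodic.convolution_mul (hp : IsZnPeriodic n v) :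
    IsZnPeriodic n (v ⋆[mul ℝ ℝ, volume] ρ) := by
  intro x k
  simp only [convolution_mul_swap]
  congr 1
  ext t
  rw [add_sub_right_comm, hp]

lemma le_convolution_mul {b : ℝ} (hv : Continuous v) (hρ : Continuous ρ)
    (hs : HasCompactSupport ρ) (h0 : ∀ x, 0 ≤ ρ x) (h1 : ∫ x, ρ x = 1)
    (x : EuclideanSpace ℝ (Fin n)) (hb : ∀ t, ρ t ≠ 0 → b ≤ v (x - t)) :
    b ≤ (v ⋆[mul ℝ ℝ, volume] ρ) x := by
  rw [convolution_mul_swap]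
  calc b = ∫ t, b * ρ t := by rw [integral_const_mul, h1, mul_one]
    _ ≤ ∫ t, v (x - t) * ρ t := by
      refine integral_mono ((hρ.integrable_of_hasCompactSupport hs).const_mul b)
        (((hv.comp (continuous_const.sub continuous_id)).mul
          hρ).integrable_of_hasCompactSupport hs.mul_left) fun t => ?_
      by_cases ht : ρ t = 0
      · simp [ht]
      · exact mul_le_mul_of_nonneg_right (hb t ht) (h0 t)

end Mollification

lemma IsZnPeriodic.exists_norm_le_one_eq {f : EuclideanSpace ℝ (Fin 2) → ℝ}
    (hf : IsZnPeriodic 2 f) (x : EuclideanSpace ℝ (Fin 2)) : ∃ y, ‖y‖ ≤ 1 ∧ f y = f x := by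
  refine ⟨x + (WithLp.equiv 2 (Fin 2 → ℝ)).symm (fun i => ((-round (x i) : ℤ) : ℝ)), ?_, hf _ _⟩
  rw [EuclideanSpace.norm_eq, Real.sqrt_le_one, Fin.sum_univ_two]
  have h0 := abs_sub_round (x 0)
  have h1 := abs_sub_round (x 1)
  simp only [Real.norm_eq_abs, sq_abs, PiLp.add_apply, WithLp.equiv_symm_apply, Int.cast_neg]
  rw [← sub_eq_add_neg, ← sub_eq_add_neg]
  rw [abs_le] at h0 h1
  nlinarith

lemma IsZnPeriodic.exists_isMin {f : EuclideanSpace ℝ (Fin 2) → ℝ} (hf : IsZnPeriodic 2 f)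
    (hc : Continuous f) : ∃ x, ‖x‖ ≤ 1 ∧ ∀ y, f x ≤ f y := by
  obtain ⟨x, hx, hmin⟩ := (isCompact_closedBall (0 : EuclideanSpace ℝ (Fin 2)) 1).exists_isMinOn
    ⟨0, by simp⟩ hc.continuousOn
  refine ⟨x, by simpa using hx, fun y => ?_⟩
  obtain ⟨z, hz, hzy⟩ := hf.exists_norm_le_one_eq y
  rw [← hzy]
  exact hmin (by simpa using hz)

/-- If `u` plus a logarithmic barrier has an interior local minimum in the punctured plane, then
`Δu ≥ 4μ` there. -/
lemma le_lapl_of_isLocalMin_add_barrier {u : EuclideanSpace ℝ (Fin 2) → ℝ}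
    (hu : ContDiff ℝ (⊤ : ℕ∞) u) (A μ : ℝ) {x : EuclideanSpace ℝ (Fin 2)} (hx : x ≠ 0)
    (hmin : IsLocalMin (fun y => u y + A * Real.log ‖y‖ - μ * ‖y‖ ^ 2) x) :
    4 * μ ≤ lapl 2 u x := by
  have hN : 0 < ‖x‖ ^ 2 := by positivity
  have key (i : Fin 2) : 0 ≤ fderiv ℝ (fun y => fderiv ℝ u y (EuclideanSpace.single i 1)) x
      (EuclideanSpace.single i 1) + A * (1 / ‖x‖ ^ 2 - 2 * x i ^ 2 / (‖x‖ ^ 2) ^ 2) - 2 * μ := by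
    set e : EuclideanSpace ℝ (Fin 2) := EuclideanSpace.single i 1 with he
    have hline (t : ℝ) : HasDerivAt (fun s : ℝ => x + s • e) e t := by
      simpa using ((hasDerivAt_id t).smul_const e).const_add x
    have hnorm (t : ℝ) : ‖x + t • e‖ ^ 2 = ‖x‖ ^ 2 + 2 * x i * t + t ^ 2 := by
      rw [norm_add_sq_real, norm_smul, inner_smul_right, he, EuclideanSpace.inner_single_right]
      simp
      ring
    have hq (t : ℝ) : HasDerivAt (fun s : ℝ => ‖x‖ ^ 2 + 2 * x i * s + s ^ 2)
        (2 * x i + 2 * t) t := by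
      simpa using (((hasDerivAt_id' t).const_mul (2 * x i)).const_add (‖x‖ ^ 2)).fun_add
        ((hasDerivAt_id' t).fun_pow 2)
    have hlm : IsLocalMin (fun t : ℝ => u (x + t • e) +
        A * (Real.log (‖x‖ ^ 2 + 2 * x i * t + t ^ 2) / 2) -
        μ * (‖x‖ ^ 2 + 2 * x i * t + t ^ 2)) 0 := by
      have hc : Tendsto (fun t : ℝ => x + t • e) (𝓝 0) (𝓝 x) := by
        simpa using (hline 0).continuousAt.tendsto
      have h2 := hc.eventually hmin
      filter_upwards [h2] with t ht
      simp only [← hnorm, Real.log_pow]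
      simpa using ht
    refine hlm.second_deriv_nonneg (f' := fun t => fderiv ℝ u (x + t • e) e +
        A * ((2 * x i + 2 * t) / (‖x‖ ^ 2 + 2 * x i * t + t ^ 2) / 2) - μ * (2 * x i + 2 * t))
        ?_ ?_
    · have hpos : ∀ᶠ t : ℝ in 𝓝 0, 0 < ‖x‖ ^ 2 + 2 * x i * t + t ^ 2 :=
        (hq 0).continuousAt.eventually (lt_mem_nhds (by simpa using hN))
      filter_upwards [hpos] with t ht
      have h1 : HasDerivAt (fun s : ℝ => u (x + s • e)) (fderiv ℝ u (x + t • e) e) t :=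
        ((hu.differentiable (by simp)) _).hasFDerivAt.comp_hasDerivAt t (hline t)
      exact (h1.add ((((hq t).log ht.ne').div_const 2).const_mul A)).sub ((hq t).const_mul μ)
    · have hD : Differentiable ℝ fun y => fderiv ℝ u y e :=
        ((hu.fderiv_right (m := (⊤ : ℕ∞)) (by norm_cast)).clm_apply
          contDiff_const).differentiable (by simp)
      have h1 : HasDerivAt (fun s : ℝ => fderiv ℝ u (x + s • e) e)
          (fderiv ℝ (fun y => fderiv ℝ u y e) x e) 0 := by
        have := (hD (x + (0 : ℝ) • e)).hasFDerivAt.comp_hasDerivAt (0 : ℝ) (hline 0)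
        simpa [Function.comp_def] using this
      have h2 : HasDerivAt (fun s : ℝ => 2 * x i + 2 * s) 2 0 := by
        simpa using ((hasDerivAt_id (0 : ℝ)).const_mul 2).const_add (2 * x i)
      have h3 := h2.div (hq 0) (by simpa using hN.ne')
      refine ((h1.add ((h3.div_const 2).const_mul A)).sub (h2.const_mul μ)).congr_deriv ?_
      simp only [mul_zero, add_zero, ne_eq, OfNat.ofNat_ne_zero, not_false_eq_true, zero_pow]
      field_simp
  have hsum : ‖x‖ ^ 2 = x 0 ^ 2 + x 1 ^ 2 := by
    simp [EuclideanSpace.norm_sq_eq, Fin.sum_univ_two]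
  have hcancel : (1 / ‖x‖ ^ 2 - 2 * x 0 ^ 2 / (‖x‖ ^ 2) ^ 2) +
      (1 / ‖x‖ ^ 2 - 2 * x 1 ^ 2 / (‖x‖ ^ 2) ^ 2) = 0 := by
    rw [hsum] at hN ⊢
    field_simp
    ring
  have h0 := key 0
  have h1 := key 1
  rw [lapl, Fin.sum_univ_two]
  linear_combination h0 + h1 + A * hcancel

/-- The corrector estimate for smooth periodic functions. -/
lemma IsZnPeriodic.lower_bound_of_lapl_le {u : EuclideanSpace ℝ (Fin 2) → ℝ}
    (hp : IsZnPeriodic 2 u) (hu : ContDiff ℝ (⊤ : ℕ∞) u) {μ b r : ℝ} (hμ : 0 < μ)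
    (hr : 0 < r) (hr1 : r ≤ 1) (hlap : ∀ x, lapl 2 u x ≤ μ) (hb : ∀ x, ‖x‖ ≤ r → -b ≤ u x)
    (x : EuclideanSpace ℝ (Fin 2)) : -b - 4 * μ / Real.log 2 * Real.log (2 / r) ≤ u x := by
  obtain ⟨x₀, hx₀, hmin⟩ := hp.exists_isMin hu.continuous
  refine le_trans ?_ (hmin x)
  have hl2 : 0 < Real.log 2 := Real.log_pos (by norm_num)
  have hlr : 0 < Real.log (2 / r) := Real.log_pos (by rw [lt_div_iff₀ hr]; linarith)
  rcases le_or_gt ‖x₀‖ r with h | hxr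
  · have : 0 ≤ 4 * μ / Real.log 2 * Real.log (2 / r) := by positivity
    linarith [hb x₀ h]
  by_contra! hlt
  set A := (-b - u x₀) / Real.log (2 / r) with hA
  have hAlog : A * Real.log (2 / r) = -b - u x₀ := by rw [hA]; field_simp
  have hA4 : 4 * μ < A * Real.log 2 := by
    rw [← div_lt_iff₀ hl2, hA, lt_div_iff₀ hlr]
    linarith
  have hApos : 0 < A := pos_of_mul_pos_left (lt_trans (by positivity) hA4) hl2.le
  set g : EuclideanSpace ℝ (Fin 2) → ℝ := fun y => u y + A * Real.log ‖y‖ - μ * ‖y‖ ^ 2 with hg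
  set K : Set (EuclideanSpace ℝ (Fin 2)) := {y | r ≤ ‖y‖ ∧ ‖y‖ ≤ 2} with hK
  have hKc : IsCompact K := by
    refine (isCompact_closedBall (0 : EuclideanSpace ℝ (Fin 2)) 2).of_isClosed_subset
      ((isClosed_le continuous_const continuous_norm).inter
        (isClosed_le continuous_norm continuous_const)) fun y hy => ?_
    simpa using hy.2
  have hgc : ContinuousOn g K := by
    refine ((hu.continuous.continuousOn).add (continuousOn_const.mul
      (continuous_norm.continuousOn.log fun y hy => ?_))).sub (by fun_prop)
    exact (hr.trans_le hy.1).ne'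
  obtain ⟨x₁, hx₁, hx₁min⟩ := hKc.exists_isMinOn ⟨x₀, hxr.le, by linarith⟩ hgc
  have hx₁0 : x₁ ≠ 0 := norm_pos_iff.1 (hr.trans_le hx₁.1)
  have hgx₀ : g x₀ < u x₀ + A * Real.log 2 - 4 * μ := by
    have : Real.log ‖x₀‖ ≤ 0 := Real.log_nonpos (norm_nonneg _) hx₀
    have : A * Real.log ‖x₀‖ ≤ 0 := mul_nonpos_of_nonneg_of_nonpos hApos.le this
    have : 0 ≤ μ * ‖x₀‖ ^ 2 := by positivity
    simp only [hg]
    linarith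
  have hle : g x₁ ≤ g x₀ := hx₁min ⟨hxr.le, by linarith⟩
  have hne1 : r < ‖x₁‖ := by
    refine lt_of_le_of_ne hx₁.1 fun heq => ?_
    have h1 : -b ≤ u x₁ := hb x₁ heq.ge
    have h2 : Real.log (2 / r) = Real.log 2 - Real.log r := Real.log_div (by norm_num) hr.ne'
    rw [h2] at hAlog
    have h3 : μ * r ^ 2 ≤ μ := mul_le_of_le_one_right hμ.le (by nlinarith)
    have h4 : g x₁ = u x₁ + A * Real.log r - μ * r ^ 2 := by simp only [hg, ← heq]
    nlinarith
  have hne2 : ‖x₁‖ < 2 := by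
    refine lt_of_le_of_ne hx₁.2 fun heq => ?_
    have h4 : g x₁ = u x₁ + A * Real.log 2 - μ * 2 ^ 2 := by simp only [hg, heq]
    linarith [hmin x₁]
  have hloc : IsLocalMin g x₁ := by
    refine hx₁min.isLocalMin ?_
    filter_upwards [continuous_norm.continuousAt.eventually (lt_mem_nhds hne1),
      continuous_norm.continuousAt.eventually (gt_mem_nhds hne2)] with y h1 h2
      using ⟨h1.le, h2.le⟩
  linarith [le_lapl_of_isLocalMin_add_barrier hu A μ hx₁0 hloc, hlap x₁]

/-- The corrector estimate for continuous periodic weak supersolutions. -/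
lemma IsZnPeriodic.lower_bound_of_lapLeWeak {v : EuclideanSpace ℝ (Fin 2) → ℝ}
    (hp : IsZnPeriodic 2 v) (hv : Continuous v) {μ b r : ℝ} (hμ : 0 < μ) (hr : 0 < r)
    (hr1 : r ≤ 1) (hw : LapLeWeak 2 univ v μ) (hb : ∀ x, ‖x‖ ≤ 2 * r → -b ≤ v x)
    (x : EuclideanSpace ℝ (Fin 2)) : -b - 4 * μ / Real.log 2 * Real.log (2 / r) ≤ v x := by
  let φ : ℕ → ContDiffBump (0 : EuclideanSpace ℝ (Fin 2)) := fun k =>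
    ⟨r / (k + 1) / 2, r / (k + 1), by positivity, half_lt_self (by positivity)⟩
  have hφ : Tendsto (fun k => (φ k).rOut) atTop (𝓝 0) := by
    simpa [φ, div_eq_mul_inv] using tendsto_one_div_add_atTop_nhds_zero_nat.const_mul r
  have hlim := ContDiffBump.convolution_tendsto_right_of_continuous
    (μ := (volume : Measure (EuclideanSpace ℝ (Fin 2)))) hφ hv x
  refine ge_of_tendsto' hlim fun k => ?_
  set ρ := (φ k).normed volume with hρdef
  have hρ : ContDiff ℝ (⊤ : ℕ∞) ρ := (φ k).contDiff_normed
  have hs : HasCompactSupport ρ := (φ k).hasCompactSupport_normed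
  have h0 : ∀ x, 0 ≤ ρ x := (φ k).nonneg_normed
  have h1 : ∫ x, ρ x = 1 := (φ k).integral_normed
  have hswap : (ρ ⋆[lsmul ℝ ℝ, volume] v) x = (v ⋆[mul ℝ ℝ, volume] ρ) x := by
    rw [convolution_lsmul_swap, convolution_def]
    simp [mul_comm]
  rw [hswap]
  refine (hp.convolution_mul (ρ := ρ)).lower_bound_of_lapl_le
    (hs.contDiff_convolution_right _ hv.locallyIntegrable hρ) hμ hr hr1
    (hw.lapl_convolution_le hv hρ hs h0 h1) (fun y hy => ?_) x
  refine le_convolution_mul hv hρ.continuous hs h0 h1 y fun t ht => hb _ ?_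
  have ht' : t ∈ Function.support ρ := ht
  rw [hρdef, ContDiffBump.support_normed_eq, mem_ball_zero_iff] at ht'
  have hk : r / ((k : ℝ) + 1) ≤ r := div_le_self hr.le (by linarith [k.cast_nonneg (α := ℝ)])
  have : ‖t‖ < r / ((k : ℝ) + 1) := ht'
  linarith [norm_sub_le y t]

/-- **Corrector height bound in dimension 2.**  If `ψ : ℝ² → ℝ` is continuous,
`ℤ²`-periodic, nonpositive, with `ψ(0) = 0` and `ψ(x) ≥ -B|x|^α` for `|x| ≤ 1/2`,
then any continuous `ℤ²`-periodic `v ≥ ψ` with `Δv ≤ μ` weakly satisfies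
`v ≥ -C μ (1 + |log μ|)`, with `C` depending only on `α` and `B`. -/
theorem corrector_bound_dim_two (α B : ℝ) (hα : α ∈ Set.Ioc (0:ℝ) 1) (hB : 0 < B) :
    ∃ C > 0, ∀ ψ : EuclideanSpace ℝ (Fin 2) → ℝ,
      Continuous ψ → IsZnPeriodic 2 ψ → (∀ x, ψ x ≤ 0) → ψ 0 = 0 →
      (∀ x : EuclideanSpace ℝ (Fin 2), ‖x‖ ≤ 1/2 → -(B * ‖x‖ ^ α) ≤ ψ x) →
      ∀ μ ∈ Set.Ioc (0:ℝ) 1, ∀ v : EuclideanSpace ℝ (Fin 2) → ℝ,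
        Continuous v → IsZnPeriodic 2 v → (∀ x, ψ x ≤ v x) →
        LapLeWeak 2 Set.univ v μ →
        ∀ x, -(C * μ * (1 + |Real.log μ|)) ≤ v x := by
  have hα0 : 0 < α := hα.1
  have hl2 : 0 < Real.log 2 := Real.log_pos (by norm_num)
  have hl8 : 0 < Real.log 8 := Real.log_pos (by norm_num)
  refine ⟨B + 4 / Real.log 2 * (Real.log 8 + 1 / α), by positivity, ?_⟩
  rintro ψ - - - - hψ μ ⟨hμ, hμ1⟩ v hv hp hψv hw x
  set s := μ ^ (1 / α) with hs
  have hs0 : 0 < s := Real.rpow_pos_of_pos hμ _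
  have hs1 : s ≤ 1 := Real.rpow_le_one hμ.le hμ1 (by positivity)
  have hsα : s ^ α = μ := by rw [hs, ← Real.rpow_mul hμ.le]; field_simp; simp
  have hb : ∀ y : EuclideanSpace ℝ (Fin 2), ‖y‖ ≤ 2 * (s / 4) → -(B * μ) ≤ v y := by
    intro y hy
    have h1 : ‖y‖ ^ α ≤ μ := by
      rw [← hsα]
      exact Real.rpow_le_rpow (norm_nonneg _) (by linarith) hα0.le
    have h2 := hψ y (by linarith)
    have h3 := mul_le_mul_of_nonneg_left h1 hB.le
    linarith [hψv y]
  have hmain := hp.lower_bound_of_lapLeWeak hv hμ (by positivity) (by linarith) hw hb x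
  have hlog : Real.log (2 / (s / 4)) = Real.log 8 + 1 / α * |Real.log μ| := by
    rw [show 2 / (s / 4) = 8 / s by field_simp; norm_num, Real.log_div (by norm_num) hs0.ne', hs,
      Real.log_rpow hμ, abs_of_nonpos (Real.log_nonpos hμ.le hμ1)]
    ring
  rw [hlog] at hmain
  refine le_trans ?_ hmain
  have hL : 0 ≤ |Real.log μ| := abs_nonneg _
  have hdiff : 0 ≤ B * μ * |Real.log μ| +
      4 / Real.log 2 * μ * (Real.log 8 * |Real.log μ| + 1 / α) := by positivity
  linear_combination hdiff
end

section
/- Let n ≥ 3, s ∈ (0,2] and B > 0. Let ψ : ℝⁿ → ℝ be continuous and ℤⁿ-periodic with ψ ≤ 0 on ℝⁿ, ψ(0) = 0, and ψ(x) ≥ −B|x|^s for all |x| ≤ 1/2. Then there exists a constant C > 0 depending only on n, s and B such that for every μ ∈ (0,1] and every continuous ℤⁿ-periodic function v : ℝⁿ → ℝ satisfying v ≥ ψ on ℝⁿ and Δv ≤ μ weakly in ℝⁿ, one has v(x) ≥ −C μ^{s/(s+n−2)} for all x ∈ ℝⁿ. In particular, the height 𝓔(μ) of the minimal such supersolution satisfies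 𝓔(μ) ≤ C μ^{s/(s+n−2)}. -/
open MeasureTheory Metric Set

theorem fderiv_fderiv_nonneg_of_isLocalMin {F : Type*} [NormedAddCommGroup F] [NormedSpace ℝ F]
    {u : F → ℝ} {x : F} (hu : ContDiffAt ℝ 2 u x) (hmin : IsLocalMin u x) (e : F) :
    0 ≤ fderiv ℝ (fun y => fderiv ℝ u y e) x e := by
  have hline : ∀ t : ℝ, HasDerivAt (fun t : ℝ => x + t • e) e t := fun t => by
    simpa using ((hasDerivAt_id t).smul_const e).const_add x
  have htend : Filter.Tendsto (fun t : ℝ => x + t • e) (nhds 0) (nhds x) := by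
    simpa using (hline 0).continuousAt.tendsto
  have hdiff : ∀ᶠ y in nhds x, DifferentiableAt ℝ u y :=
    (hu.eventually (by simp)).mono fun y hy => hy.differentiableAt (by norm_num)
  have hderiv : deriv (fun t : ℝ => u (x + t • e)) =ᶠ[nhds 0]
      fun t => fderiv ℝ u (x + t • e) e :=
    (htend.eventually hdiff).mono fun t ht =>
      (ht.hasFDerivAt.comp_hasDerivAt t (hline t)).deriv
  have hfd : DifferentiableAt ℝ (fun y => fderiv ℝ u y e) x :=
    ((hu.fderiv_right (m := 1) (by norm_num)).differentiableAt (by norm_num)).clm_apply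
      (differentiableAt_const e)
  have hdd : deriv (deriv (fun t : ℝ => u (x + t • e))) 0 =
      fderiv ℝ (fun y => fderiv ℝ u y e) x e := by
    rw [hderiv.deriv_eq]
    refine HasDerivAt.deriv ?_
    refine HasFDerivAt.comp_hasDerivAt (0 : ℝ) (l := fun y => fderiv ℝ u y e) ?_ (hline 0)
    simpa using hfd.hasFDerivAt
  have hgmin : IsLocalMin (fun t : ℝ => u (x + t • e)) 0 := by
    have := htend.eventually hmin
    simpa [IsLocalMin, IsMinFilter] using this
  by_contra! hneg
  have hgmax := isLocalMax_of_deriv_deriv_neg (hdd ▸ hneg) hgmin.deriv_eq_zero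
    (by
      refine ContinuousAt.comp (g := u) ?_ (hline 0).continuousAt
      simpa using hu.continuousAt)
  have hconst : (fun t : ℝ => u (x + t • e)) =ᶠ[nhds 0] fun _ => u (x + (0 : ℝ) • e) := by
    filter_upwards [hgmin, hgmax] with t h₁ h₂ using le_antisymm h₂ h₁
  have hzero : deriv (deriv (fun t : ℝ => u (x + t • e))) 0 = 0 := by
    rw [hconst.deriv.deriv_eq]
    simp
  linarith

theorem lapl_nonneg_of_isLocalMin {n : ℕ} {u : EuclideanSpace ℝ (Fin n) → ℝ}
    {x : EuclideanSpace ℝ (Fin n)} (hu : ContDiffAt ℝ 2 u x) (hmin : IsLocalMin u x) :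
    0 ≤ lapl n u x :=
  Finset.sum_nonneg fun _ _ => fderiv_fderiv_nonneg_of_isLocalMin hu hmin _

theorem lapl_add {n : ℕ} {f g : EuclideanSpace ℝ (Fin n) → ℝ} {x : EuclideanSpace ℝ (Fin n)}
    (hf : ContDiffAt ℝ 2 f x) (hg : ContDiffAt ℝ 2 g x) :
    lapl n (fun y => f y + g y) x = lapl n f x + lapl n g x := by
  have hdiff : ∀ {h : EuclideanSpace ℝ (Fin n) → ℝ}, ContDiffAt ℝ 2 h x →
      ∀ᶠ y in nhds x, DifferentiableAt ℝ h y := fun hh =>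
    (hh.eventually (by simp)).mono fun y hy => hy.differentiableAt (by norm_num)
  have hfd : ∀ {h : EuclideanSpace ℝ (Fin n) → ℝ}, ContDiffAt ℝ 2 h x →
      ∀ e, DifferentiableAt ℝ (fun y => fderiv ℝ h y e) x := fun hh e =>
    ((hh.fderiv_right (m := 1) (by norm_num)).differentiableAt (by norm_num)).clm_apply
      (differentiableAt_const e)
  simp only [lapl, ← Finset.sum_add_distrib]
  refine Finset.sum_congr rfl fun i _ => ?_
  have heq : (fun y => fderiv ℝ (fun y => f y + g y) y (EuclideanSpace.single i 1)) =ᶠ[nhds x]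
      fun y => fderiv ℝ f y (EuclideanSpace.single i 1) +
        fderiv ℝ g y (EuclideanSpace.single i 1) := by
    filter_upwards [hdiff hf, hdiff hg] with y h₁ h₂
    rw [fderiv_fun_add h₁ h₂, add_apply]
  rw [heq.fderiv_eq, fderiv_fun_add (hfd hf _) (hfd hg _), add_apply]

theorem lapl_const_mul {n : ℕ} (c : ℝ) (f : EuclideanSpace ℝ (Fin n) → ℝ)
    (x : EuclideanSpace ℝ (Fin n)) :
    lapl n (fun y => c * f y) x = c * lapl n f x := by
  simp only [lapl, ← smul_eq_mul, Finset.smul_sum]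
  refine Finset.sum_congr rfl fun i _ => ?_
  simp only [← Pi.smul_def, fderiv_const_smul_field]
  change fderiv ℝ (c • fun y => fderiv ℝ f y (EuclideanSpace.single i 1)) x _ = _
  rw [fderiv_const_smul_field]
  rfl

theorem lapl_norm_sq_rpow {n : ℕ} (p : ℝ) {x : EuclideanSpace ℝ (Fin n)} (hx : x ≠ 0) :
    lapl n (fun y => (‖y‖ ^ 2) ^ p) x = 2 * p * (2 * p - 2 + n) * (‖x‖ ^ 2) ^ (p - 1) := by
  have hder : ∀ (q : ℝ) {y : EuclideanSpace ℝ (Fin n)}, y ≠ 0 →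
      HasFDerivAt (fun z : EuclideanSpace ℝ (Fin n) => (‖z‖ ^ 2) ^ q)
        ((q * (‖y‖ ^ 2) ^ (q - 1)) • (2 : ℕ) • innerSL ℝ y) y := fun q y hy => by
    have h := (HasStrictFDerivAt.hasFDerivAt (hasStrictFDerivAt_norm_sq y)).rpow_const (p := q)
      (Or.inl (by positivity))
    simpa using h
  have hsum : ∑ i, x i ^ 2 = ‖x‖ ^ 2 := by
    rw [EuclideanSpace.norm_sq_eq]; simp
  have hterm : ∀ i : Fin n,
      fderiv ℝ (fun y => fderiv ℝ (fun y => (‖y‖ ^ 2) ^ p) y (EuclideanSpace.single i 1)) x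
        (EuclideanSpace.single i 1) =
      2 * p * (2 * (p - 1) * (‖x‖ ^ 2) ^ (p - 1 - 1) * x i ^ 2 + (‖x‖ ^ 2) ^ (p - 1)) := by
    intro i
    have heq : (fun y => fderiv ℝ (fun y => (‖y‖ ^ 2) ^ p) y (EuclideanSpace.single i 1))
        =ᶠ[nhds x] fun y => 2 * p * ((‖y‖ ^ 2) ^ (p - 1) * y i) := by
      filter_upwards [isOpen_ne.mem_nhds hx] with y hy
      rw [(hder p hy).fderiv]
      simp [EuclideanSpace.inner_single_right]
      ring
    have hcoord : HasFDerivAt (fun y : EuclideanSpace ℝ (Fin n) => y i)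
        (EuclideanSpace.proj i : EuclideanSpace ℝ (Fin n) →L[ℝ] ℝ) x :=
      (EuclideanSpace.proj i : EuclideanSpace ℝ (Fin n) →L[ℝ] ℝ).hasFDerivAt
    have hprod : fderiv ℝ (fun y => 2 * p * ((‖y‖ ^ 2) ^ (p - 1) * y i)) x = _ :=
      (((hder (p - 1) hx).mul hcoord).const_mul (2 * p)).fderiv
    rw [heq.fderiv_eq, hprod]
    simp [EuclideanSpace.inner_single_right]
    ring
  have hpow : (‖x‖ ^ 2) ^ (p - 1 - 1) * ‖x‖ ^ 2 = (‖x‖ ^ 2) ^ (p - 1) := by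
    have hpos : 0 < ‖x‖ ^ 2 := by positivity
    rw [Real.rpow_sub_one hpos.ne' (p - 1)]
    field_simp
  simp only [lapl, hterm]
  rw [← Finset.mul_sum, Finset.sum_add_distrib, ← Finset.mul_sum, hsum, mul_assoc (2 * (p - 1)),
    hpow]
  simp
  ring

/-- The mollification of a weak supersolution is a classical supersolution. -/
theorem exists_contDiff_approx_of_lapLeWeak {n : ℕ} {v : EuclideanSpace ℝ (Fin n) → ℝ} {c : ℝ}
    (hv : Continuous v) (hweak : LapLeWeak n Set.univ v c) (R : ℝ) {δ : ℝ} (hδ : 0 < δ) :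
    ∃ u : EuclideanSpace ℝ (Fin n) → ℝ, ContDiff ℝ 2 u ∧ (∀ x, lapl n u x ≤ c) ∧
      ∀ x ∈ closedBall 0 R, |u x - v x| ≤ δ := by
  obtain ⟨η, hη, hclose⟩ := Metric.uniformContinuousOn_iff.1
    ((isCompact_closedBall (0 : EuclideanSpace ℝ (Fin n)) (R + 1)).uniformContinuousOn_of_continuous
      hv.continuousOn) δ hδ
  let ρ : ContDiffBump (0 : EuclideanSpace ℝ (Fin n)) :=
    ⟨min η 1 / 2, min η 1, by positivity, half_lt_self (by positivity)⟩
  set k : EuclideanSpace ℝ (Fin n) → ℝ := ρ.normed volume with hk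
  have hksmooth : ContDiff ℝ (⊤ : ℕ∞) k := ρ.contDiff_normed
  have hksupp : HasCompactSupport k := ρ.hasCompactSupport_normed
  have hvloc : LocallyIntegrable v := hv.locallyIntegrable
  let L := ContinuousLinearMap.lsmul ℝ ℝ (E := ℝ)
  have hdir : ∀ {g : EuclideanSpace ℝ (Fin n) → ℝ}, HasCompactSupport g →
      ContDiff ℝ (⊤ : ℕ∞) g → ∀ e x, fderiv ℝ (convolution v g L volume) x e =
        convolution v (fun y => fderiv ℝ g y e) L volume x := by
    intro g hg hg' e x
    have hg1 : ContDiff ℝ 1 g := hg'.of_le (by norm_cast)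
    rw [(hg.hasFDerivAt_convolution_right L hvloc hg1 x).fderiv]
    exact convolution_precompR_apply L hvloc (hg.fderiv ℝ)
      (hg1.continuous_fderiv one_ne_zero) x e
  have hddsupp : ∀ e, HasCompactSupport fun y => fderiv ℝ k y e := fun e =>
    hksupp.fderiv_apply ℝ e
  have hdsmooth : ∀ e, ContDiff ℝ (⊤ : ℕ∞) fun y => fderiv ℝ k y e := fun e =>
    (hksmooth.fderiv_right (m := (⊤ : ℕ∞)) (by norm_cast)).clm_apply contDiff_const
  have hd2supp : ∀ e, HasCompactSupport fun y => fderiv ℝ (fun z => fderiv ℝ k z e) y e :=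
    fun e => (hddsupp e).fderiv_apply ℝ e
  have hd2cont : ∀ e, Continuous fun y => fderiv ℝ (fun z => fderiv ℝ k z e) y e := fun e =>
    ((hdsmooth e).continuous_fderiv (by simp)).clm_apply continuous_const
  have hreflect : ∀ {g : EuclideanSpace ℝ (Fin n) → ℝ}, ContDiff ℝ (⊤ : ℕ∞) g → ∀ x y e,
      fderiv ℝ (fun z => g (x - z)) y e = -fderiv ℝ g (x - y) e := by
    intro g hg x y e
    have h := (hg.differentiable (by simp) (x - y)).hasFDerivAt.comp y
      ((hasFDerivAt_id y).const_sub x)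
    have h' : fderiv ℝ (fun z => g (x - z)) y = _ := h.fderiv
    rw [h']
    simp
  refine ⟨convolution v k L volume, ?_, fun x => ?_, fun x hx => ?_⟩
  · exact hksupp.contDiff_convolution_right L hvloc (hksmooth.of_le (by norm_cast))
  · have hlapl : lapl n (convolution v k L volume) x = ∫ y, v y * lapl n k (x - y) := by
      have hterm : ∀ i : Fin n,
          fderiv ℝ (fun y => fderiv ℝ (convolution v k L volume) y (EuclideanSpace.single i 1)) x
            (EuclideanSpace.single i 1) = ∫ y, v y * fderiv ℝ (fun z => fderiv ℝ k z
              (EuclideanSpace.single i 1)) (x - y) (EuclideanSpace.single i 1) := by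
        intro i
        rw [funext (hdir hksupp hksmooth (EuclideanSpace.single i 1)),
          hdir (hddsupp _) (hdsmooth _)]
        rfl
      rw [lapl, Finset.sum_congr rfl fun i _ => hterm i, ← integral_finsetSum]
      · simp only [lapl, Finset.mul_sum]
      · intro i _
        exact (hd2supp (EuclideanSpace.single i 1)).convolutionExists_right L hvloc
          (hd2cont (EuclideanSpace.single i 1)) x
    have hlapl' : ∀ y, lapl n (fun z => k (x - z)) y = lapl n k (x - y) := by
      intro y
      refine Finset.sum_congr rfl fun i _ => ?_
      simp only [hreflect hksmooth]
      rw [fderiv_fun_neg, neg_apply, hreflect (hdsmooth _), neg_neg]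
    have hsupp' : HasCompactSupport fun z => k (x - z) :=
      hksupp.comp_homeomorph (Homeomorph.subLeft x)
    have h := hweak (fun z => k (x - z))
      (hksmooth.comp (contDiff_const.sub contDiff_id)) hsupp' (Set.subset_univ _)
      fun z => ρ.nonneg_normed _
    simp only [hlapl', setIntegral_univ] at h
    rw [integral_sub_left_eq_self k volume x, hk, ρ.integral_normed, mul_one] at h
    rwa [hlapl]
  · have hx' : ‖x‖ ≤ R := by simpa using hx
    have hswap : convolution v k L volume x = convolution k v L volume x := by
      rw [convolution_lsmul_swap, convolution_lsmul]
      simp [mul_comm]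
    rw [hswap, ← Real.dist_eq]
    refine ρ.dist_normed_convolution_le hv.aestronglyMeasurable fun y hy => ?_
    have hy' : dist y x < min η 1 := hy
    refine (hclose y ?_ x ?_ (hy'.trans_le (min_le_left _ _))).le
    · have h₁ := hy'.trans_le (min_le_right _ _)
      have h₂ := norm_le_norm_add_norm_sub' y x
      rw [dist_eq_norm] at h₁
      simp only [mem_closedBall_zero_iff]
      linarith
    · simp only [mem_closedBall_zero_iff]
      linarith

/-- Comparison with a radial subsolution in the annulus `r ≤ ‖x‖ ≤ R`. -/
theorem radial_le_of_lapLeWeak {n : ℕ} (hn : n ≠ 0) {v : EuclideanSpace ℝ (Fin n) → ℝ}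
    {c r R m A : ℝ} (hv : Continuous v) (hweak : LapLeWeak n Set.univ v c) (hc : 0 < c)
    (hr : 0 < r) (hrR : r ≤ R) (hA : 0 ≤ A) (hout : ∀ y, ‖y‖ = R → m ≤ v y)
    (hin : ∀ y, ‖y‖ = r → m + A * (r ^ 2) ^ ((2 - n : ℝ) / 2) ≤ v y)
    {x : EuclideanSpace ℝ (Fin n)} (hrx : r ≤ ‖x‖) (hxR : ‖x‖ ≤ R) :
    m + A * ((‖x‖ ^ 2) ^ ((2 - n : ℝ) / 2) - (R ^ 2) ^ ((2 - n : ℝ) / 2)) +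
      c / n * (‖x‖ ^ 2 - R ^ 2) ≤ v x := by
  have hn' : (0 : ℝ) < n := by positivity
  refine le_of_forall_pos_le_add fun δ hδ => ?_
  obtain ⟨u, hu, hlap, hclose⟩ := exists_contDiff_approx_of_lapLeWeak hv hweak R (half_pos hδ)
  set p : ℝ := (2 - n : ℝ) / 2 with hp
  set w : EuclideanSpace ℝ (Fin n) → ℝ := fun y =>
    u y + (-A * (‖y‖ ^ 2) ^ p + -(c / n) * (‖y‖ ^ 2) ^ (1 : ℝ)) with hw
  have hsmooth : ∀ (q : ℝ) {y : EuclideanSpace ℝ (Fin n)}, y ≠ 0 →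
      ContDiffAt ℝ 2 (fun y : EuclideanSpace ℝ (Fin n) => (‖y‖ ^ 2) ^ q) y := fun q y hy =>
    (contDiff_norm_sq ℝ).contDiffAt.rpow_const_of_ne (by positivity)
  have hb : ∀ {y : EuclideanSpace ℝ (Fin n)}, y ≠ 0 → ContDiffAt ℝ 2
      (fun y : EuclideanSpace ℝ (Fin n) => -A * (‖y‖ ^ 2) ^ p + -(c / n) * (‖y‖ ^ 2) ^ (1 : ℝ)) y :=
    fun hy => (contDiffAt_const.mul (hsmooth p hy)).add (contDiffAt_const.mul (hsmooth 1 hy))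
  have hwsmooth : ∀ {y : EuclideanSpace ℝ (Fin n)}, y ≠ 0 → ContDiffAt ℝ 2 w y := fun hy =>
    hu.contDiffAt.add (hb hy)
  have hwlap : ∀ {y : EuclideanSpace ℝ (Fin n)}, y ≠ 0 → lapl n w y < 0 := by
    intro y hy
    have h : lapl n w y = lapl n u y - 2 * c := by
      rw [hw, lapl_add hu.contDiffAt (hb hy), lapl_add
        (contDiffAt_const.mul (hsmooth p hy)) (contDiffAt_const.mul (hsmooth 1 hy)),
        lapl_const_mul, lapl_const_mul, lapl_norm_sq_rpow p hy, lapl_norm_sq_rpow 1 hy]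
      have hz : 2 * p - 2 + n = 0 := by rw [hp]; ring
      rw [hz]
      simp
      field_simp
      ring
    linarith [hlap y]
  have hne : ∀ {y : EuclideanSpace ℝ (Fin n)}, r ≤ ‖y‖ → y ≠ 0 := fun hy =>
    norm_pos_iff.1 (hr.trans_le hy)
  have hK : IsCompact (closedBall (0 : EuclideanSpace ℝ (Fin n)) R ∩ {y | r ≤ ‖y‖}) :=
    (isCompact_closedBall _ _).inter_right (isClosed_le continuous_const continuous_norm)
  obtain ⟨z, ⟨hzR, hzr⟩, hzmin⟩ := hK.exists_isMinOn ⟨x, by simpa using hxR, hrx⟩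
    fun y hy => (hwsmooth (hne hy.2)).continuousAt.continuousWithinAt
  have hzR' : ‖z‖ ≤ R := by simpa using hzR
  have hboundary : ‖z‖ = r ∨ ‖z‖ = R := by
    by_contra! hint
    have hnhds : closedBall (0 : EuclideanSpace ℝ (Fin n)) R ∩ {y | r ≤ ‖y‖} ∈ nhds z := by
      filter_upwards [continuous_norm.continuousAt.eventually_lt continuousAt_const
          (lt_of_le_of_ne hzR' hint.2),
        continuousAt_const.eventually_lt continuous_norm.continuousAt
          (lt_of_le_of_ne hzr hint.1.symm)] with y h₁ h₂
      exact ⟨by simpa using h₁.le, h₂.le⟩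
    exact (hwlap (hne hzr)).not_ge
      (lapl_nonneg_of_isLocalMin (hwsmooth (hne hzr)) (hzmin.isLocalMin hnhds))
  have hwz : m - A * (R ^ 2) ^ p - c / n * R ^ 2 - δ / 2 ≤ w z := by
    have huz := (abs_le.1 (hclose z hzR)).1
    simp only [hw, Real.rpow_one]
    rcases hboundary with h | h
    · have hvz := hin z h
      have h₁ : c / n * r ^ 2 ≤ c / n * R ^ 2 := by gcongr
      have h₂ : 0 ≤ A * (R ^ 2) ^ p := by positivity
      rw [h]
      linarith
    · have hvz := hout z h
      rw [h]
      linarith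
  have hwx : w z ≤ w x := hzmin ⟨by simpa using hxR, hrx⟩
  have hux := (abs_le.1 (hclose x (by simpa using hxR))).2
  simp only [hw, Real.rpow_one] at hwz hwx
  linarith

theorem IsZnPeriodic.exists_forall_le {n : ℕ} {v : EuclideanSpace ℝ (Fin n) → ℝ}
    (hper : IsZnPeriodic n v) (hv : Continuous v) :
    ∃ x₀, ‖x₀‖ ≤ n ∧ ∀ x, v x₀ ≤ v x := by
  obtain ⟨x₀, hx₀, hmin⟩ := (isCompact_closedBall (0 : EuclideanSpace ℝ (Fin n)) n).exists_isMinOn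
    ⟨0, by simp⟩ hv.continuousOn
  refine ⟨x₀, by simpa using hx₀, fun x => ?_⟩
  rw [← hper x fun i => -⌊x i⌋]
  refine hmin (mem_closedBall_zero_iff.2 ?_)
  rw [EuclideanSpace.norm_eq]
  refine Real.sqrt_le_iff.2 ⟨by positivity, ?_⟩
  calc ∑ i, ‖(x + (WithLp.equiv 2 (Fin n → ℝ)).symm fun i => ((-⌊x i⌋ : ℤ) : ℝ)) i‖ ^ 2
      ≤ ∑ _i : Fin n, (1 : ℝ) := by
        refine Finset.sum_le_sum fun i _ => ?_
        have h : (x + (WithLp.equiv 2 (Fin n → ℝ)).symm fun i => ((-⌊x i⌋ : ℤ) : ℝ)) i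
            = Int.fract (x i) := by
          simp [Int.fract, sub_eq_add_neg]
        rw [h, Real.norm_of_nonneg (Int.fract_nonneg _)]
        exact pow_le_one₀ (Int.fract_nonneg _) (Int.fract_lt_one _).le
    _ ≤ (n : ℝ) ^ 2 := by
        simp only [Finset.sum_const, Finset.card_univ, Fintype.card_fin, nsmul_eq_mul, mul_one]
        exact_mod_cast Nat.le_self_pow two_ne_zero n

/-- **Corrector height bound in dimension `n ≥ 3`, `C^s` obstacle.**  If `ψ : ℝⁿ → ℝ`
is continuous, `ℤⁿ`-periodic, nonpositive, with `ψ(0) = 0` and `ψ(x) ≥ -B|x|^s` for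
`|x| ≤ 1/2`, then any continuous `ℤⁿ`-periodic `v ≥ ψ` with `Δv ≤ μ` weakly
satisfies `v ≥ -C μ^{s/(s+n-2)}`, with `C = C(n, s, B)`. -/
theorem corrector_bound_Cs (n : ℕ) (hn : 3 ≤ n) (s B : ℝ) (hs : s ∈ Set.Ioc (0:ℝ) 2)
    (hB : 0 < B) :
    ∃ C > 0, ∀ ψ : EuclideanSpace ℝ (Fin n) → ℝ,
      Continuous ψ → IsZnPeriodic n ψ → (∀ x, ψ x ≤ 0) → ψ 0 = 0 →
      (∀ x : EuclideanSpace ℝ (Fin n), ‖x‖ ≤ 1/2 → -(B * ‖x‖ ^ s) ≤ ψ x) →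
      ∀ μ ∈ Set.Ioc (0:ℝ) 1, ∀ v : EuclideanSpace ℝ (Fin n) → ℝ,
        Continuous v → IsZnPeriodic n v → (∀ x, ψ x ≤ v x) →
        LapLeWeak n Set.univ v μ →
        ∀ x, -(C * μ ^ (s / (s + n - 2))) ≤ v x := by
  obtain ⟨hs0, -⟩ := hs
  have hn3 : (3 : ℝ) ≤ n := by exact_mod_cast hn
  have hn0 : (0 : ℝ) < n := by linarith
  set p : ℝ := (2 - n : ℝ) / 2 with hp
  set D : ℝ := ((n : ℝ) ^ 2) ^ p with hD
  have hDpos : 0 < D := by positivity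
  refine ⟨B + 8 * n / D * 2 ^ ((n : ℝ) - 2), by positivity, ?_⟩
  intro ψ _ _ _ _ hψB μ hμ v hv hper hψv hweak x
  obtain ⟨hμ0, hμ1⟩ := hμ
  obtain ⟨x₀, hx₀n, hmin⟩ := hper.exists_forall_le hv
  refine le_trans ?_ (hmin x)
  have hd : 0 < s + n - 2 := by linarith
  set r : ℝ := μ ^ (1 / (s + n - 2)) / 2 with hr
  have hr0 : 0 < r := by positivity
  have hr1 : r ≤ 1 / 2 := by
    rw [hr]
    gcongr
    exact Real.rpow_le_one hμ0.le hμ1 (by positivity)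
  have hrs : r ^ s ≤ μ ^ (s / (s + n - 2)) := by
    calc r ^ s ≤ (μ ^ (1 / (s + n - 2))) ^ s := by
          gcongr
          exact half_le_self (by positivity)
      _ = μ ^ (s / (s + n - 2)) := by
          rw [← Real.rpow_mul hμ0.le]
          congr 1
          ring
  have hrp : μ * (r ^ 2) ^ p = 2 ^ ((n : ℝ) - 2) * μ ^ (s / (s + n - 2)) := by
    have h₁ : (r ^ 2) ^ p = r ^ (2 - n : ℝ) := by
      rw [← Real.rpow_natCast, ← Real.rpow_mul hr0.le, hp]
      congr 1
      push_cast
      ring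
    have h₂ : ((2 : ℝ) ^ (2 - n : ℝ))⁻¹ = 2 ^ ((n : ℝ) - 2) := by
      rw [← Real.rpow_neg zero_le_two, neg_sub]
    have h₃ : μ * μ ^ (1 / (s + n - 2) * (2 - n : ℝ)) = μ ^ (s / (s + n - 2)) := by
      rw [← Real.rpow_one_add' hμ0.le]
      · congr 1
        field_simp
        ring
      · have : 1 + 1 / (s + n - 2) * (2 - n : ℝ) = s / (s + n - 2) := by
          field_simp
          ring
        rw [this]
        positivity
    rw [h₁, hr, Real.div_rpow (by positivity) zero_le_two, ← Real.rpow_mul hμ0.le, div_eq_mul_inv,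
      h₂, ← mul_assoc, h₃, mul_comm]
  have hBr : B * r ^ s ≤ B * μ ^ (s / (s + n - 2)) := by gcongr
  have hrest : 0 ≤ 8 * n / D * 2 ^ ((n : ℝ) - 2) * μ ^ (s / (s + n - 2)) := by positivity
  rcases le_or_gt (-(B * r ^ s)) (v x₀) with hle | hlt
  · rw [add_mul]
    linarith
  have hvr : ∀ y : EuclideanSpace ℝ (Fin n), ‖y‖ ≤ r → -(B * r ^ s) ≤ v y := by
    intro y hy
    have h₁ : B * ‖y‖ ^ s ≤ B * r ^ s := by gcongr
    linarith [hψB y (hy.trans hr1), hψv y]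
  have hrx₀ : r ≤ ‖x₀‖ := by
    by_contra! h
    exact (hvr x₀ h.le).not_gt hlt
  have hx₀pos : 0 < ‖x₀‖ := hr0.trans_le hrx₀
  set A : ℝ := (-(B * r ^ s) - v x₀) / (r ^ 2) ^ p with hA
  have hrpos : 0 < (r ^ 2) ^ p := by positivity
  have hA0 : 0 ≤ A := div_nonneg (by linarith) hrpos.le
  have hAr : A * (r ^ 2) ^ p = -(B * r ^ s) - v x₀ := div_mul_cancel₀ _ hrpos.ne'
  have hcomp := radial_le_of_lapLeWeak (R := 2 * n) (by omega) hv hweak hμ0 hr0 (by linarith) hA0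
    (fun y _ => hmin y) (fun y hy => by
      rw [← hp, hAr]
      linarith [hvr y hy.le]) hrx₀ (by linarith)
  rw [← hp] at hcomp
  have hp0 : p ≤ -(1 / 2) := by rw [hp]; linarith
  have hx₀D : D ≤ (‖x₀‖ ^ 2) ^ p :=
    Real.rpow_le_rpow_of_nonpos (by positivity) (by gcongr) (by linarith)
  have hRD : ((2 * n : ℝ) ^ 2) ^ p ≤ D / 2 := by
    have h4 : (4 : ℝ) ^ p ≤ 1 / 2 := by
      calc (4 : ℝ) ^ p ≤ 4 ^ (-(1 / 2) : ℝ) :=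
            Real.rpow_le_rpow_of_exponent_le (by norm_num) hp0
        _ = 1 / 2 := by
            rw [Real.rpow_neg (by norm_num), ← Real.sqrt_eq_rpow,
              show (4 : ℝ) = 2 ^ 2 by norm_num, Real.sqrt_sq zero_le_two]
            norm_num
    rw [mul_pow, Real.mul_rpow (by positivity) (by positivity), ← hD,
      show (2 : ℝ) ^ 2 = 4 by norm_num]
    nlinarith
  have hAD : A * (D / 2) ≤ A * ((‖x₀‖ ^ 2) ^ p - ((2 * n : ℝ) ^ 2) ^ p) := by
    gcongr
    linarith
  have hquad : -(4 * n * μ) ≤ μ / n * (‖x₀‖ ^ 2 - (2 * n) ^ 2) := by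
    have h₁ : 0 ≤ μ / n * ‖x₀‖ ^ 2 := by positivity
    have h₂ : μ / n * (2 * n) ^ 2 = 4 * n * μ := by
      field_simp
      ring
    linarith
  have hAle : A ≤ 8 * n / D * μ := by
    rw [div_mul_eq_mul_div, le_div_iff₀ hDpos]
    linarith
  have hfinal : -(B * r ^ s) - v x₀ ≤ 8 * n / D * 2 ^ ((n : ℝ) - 2) * μ ^ (s / (s + n - 2)) := by
    calc -(B * r ^ s) - v x₀ = A * (r ^ 2) ^ p := hAr.symm
      _ ≤ 8 * n / D * μ * (r ^ 2) ^ p := by gcongr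
      _ = _ := by rw [mul_assoc, hrp, mul_assoc]
  rw [add_mul]
  linarith
end

section
/- Let U ⊆ ℝⁿ be open, λ ∈ (0,1], σ ≥ 0, and let Λ ⊆ U be relatively closed in U. Let w : U → ℝ be continuous with w ≥ −σ² in U, w ≤ 0 on Λ, and Δw ≥ λ weakly in the open set U ∖ Λ. Suppose z ∈ U satisfies dist(z, Λ) > (2n/λ)^{1/2} σ (where dist(z, ∅) = +∞), and let r > 0 be such that the closed ball cl(B_r(z)) is contained in U. Then sup over cl(B_r(z)) of w is at least (λ/(2n)) r² − σ². -/
open MeasureTheory Metric Set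

/-- `Δw ≥ c` weakly in `V`. -/
def LapGeWeak (n : ℕ) (V : Set (EuclideanSpace ℝ (Fin n)))
    (w : EuclideanSpace ℝ (Fin n) → ℝ) (c : ℝ) : Prop :=
  ∀ φ : EuclideanSpace ℝ (Fin n) → ℝ, ContDiff ℝ (⊤ : ℕ∞) φ → HasCompactSupport φ →
    tsupport φ ⊆ V → (∀ x, 0 ≤ φ x) →
    c * ∫ x in V, φ x ≤ ∫ x in V, w x * lapl n φ x

open Filter Topology

theorem IsLocalMax.second_deriv_nonpos {h h' : ℝ → ℝ} {h2 x : ℝ}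
    (hh : ∀ t, HasDerivAt h (h' t) t) (hh' : HasDerivAt h' h2 x) (hmax : IsLocalMax h x) :
    h2 ≤ 0 := by
  by_contra! hpos
  have hd : deriv h = h' := funext fun t => (hh t).deriv
  have hmin : IsLocalMin h x := isLocalMin_of_deriv_deriv_pos
    (by rwa [hd, hh'.deriv]) hmax.deriv_eq_zero (hh x).continuousAt
  have hconst : h =ᶠ[𝓝 x] fun _ => h x := by
    filter_upwards [hmin, hmax] with t h₁ h₂ using le_antisymm h₂ h₁
  have hzero : h' =ᶠ[𝓝 x] fun _ => 0 := by
    rw [← hd]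
    simpa using hconst.deriv
  have := hzero.deriv_eq
  rw [hh'.deriv, deriv_const] at this
  exact hpos.ne' this

theorem hasDerivAt_norm_sub_sq_line {E : Type*} [NormedAddCommGroup E] [InnerProductSpace ℝ E]
    (x z e : E) (t : ℝ) :
    HasDerivAt (fun t : ℝ => ‖x + t • e - z‖ ^ 2)
      (2 * inner ℝ (x - z) e + 2 * t * ‖e‖ ^ 2) t := by
  have hexp : (fun t : ℝ => ‖x + t • e - z‖ ^ 2) =
      fun t => ‖x - z‖ ^ 2 + 2 * (t * inner ℝ (x - z) e) + t ^ 2 * ‖e‖ ^ 2 := by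
    funext t
    rw [add_sub_right_comm, norm_add_sq_real, inner_smul_right, norm_smul, mul_pow,
      Real.norm_eq_abs, sq_abs]
  rw [hexp]
  have h₁ := ((hasDerivAt_id t).mul_const (inner ℝ (x - z) e)).const_mul 2
  have h₂ := ((hasDerivAt_id t).pow 2).mul_const (‖e‖ ^ 2)
  exact ((h₁.const_add (‖x - z‖ ^ 2)).add h₂).congr_deriv (by simp)

theorem hasDerivAt_integral_mul_comp_sub_line {E : Type*} [NormedAddCommGroup E]
    [NormedSpace ℝ E] [MeasurableSpace E] [BorelSpace E] [SecondCountableTopology E]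
    {μ : Measure E} {g f : E → ℝ} (hg : Integrable g μ) (hf : ContDiff ℝ 1 f)
    (hfc : HasCompactSupport f) (x e : E) (t : ℝ) :
    HasDerivAt (fun t : ℝ => ∫ y, g y * f (y - (x + t • e)) ∂μ)
      (-∫ y, g y * fderiv ℝ f (y - (x + t • e)) e ∂μ) t := by
  have hcont : Continuous fun y => fderiv ℝ f y e :=
    (hf.continuous_fderiv one_ne_zero).clm_apply continuous_const
  obtain ⟨C, hC⟩ := hcont.bounded_above_of_compact_support (hfc.fderiv_apply (𝕜 := ℝ) e)
  obtain ⟨B, hB⟩ := hf.continuous.bounded_above_of_compact_support hfc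
  rw [← integral_neg]
  refine (hasDerivAt_integral_of_dominated_loc_of_deriv_le
    (F := fun (t : ℝ) y => g y * f (y - (x + t • e)))
    (F' := fun (t : ℝ) y => -(g y * fderiv ℝ f (y - (x + t • e)) e))
    (bound := fun y => ‖g y‖ * C) univ_mem ?_ ?_ ?_ ?_ ?_ ?_).2
  · exact Eventually.of_forall fun s => hg.aestronglyMeasurable.mul
      (hf.continuous.comp (continuous_id.sub continuous_const)).aestronglyMeasurable
  · exact hg.mul_bdd (c := B)
      (hf.continuous.comp (continuous_id.sub continuous_const)).aestronglyMeasurable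
      (ae_of_all _ fun y => hB _)
  · exact (hg.aestronglyMeasurable.mul
      (hcont.comp (continuous_id.sub continuous_const)).aestronglyMeasurable).neg
  · refine ae_of_all _ fun y s _ => ?_
    rw [norm_neg, norm_mul]
    exact mul_le_mul_of_nonneg_left (hC _) (norm_nonneg _)
  · exact hg.norm.mul_const C
  · refine ae_of_all _ fun y s _ => ?_
    have hline : HasDerivAt (fun s : ℝ => y - (x + s • e)) (-e) s := by
      simpa using (((hasDerivAt_id s).smul_const e).const_add x).const_sub y
    have hcomp := ((hf.differentiable one_ne_zero _).hasFDerivAt.comp_hasDerivAt s hline).const_mul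
      (g y)
    simpa using hcomp

theorem lapl_comp_sub (n : ℕ) (f : EuclideanSpace ℝ (Fin n) → ℝ)
    (a x : EuclideanSpace ℝ (Fin n)) :
    lapl n (fun y => f (y - a)) x = lapl n f (x - a) := by
  simp only [lapl, fderiv_comp_sub]
  refine Finset.sum_congr rfl fun i _ => ?_
  rw [fderiv_comp_sub (f := fun y => fderiv ℝ f y (EuclideanSpace.single i 1))]

theorem lapl_eq_zero_of_notMem_tsupport {n : ℕ} {f : EuclideanSpace ℝ (Fin n) → ℝ}
    {x : EuclideanSpace ℝ (Fin n)} (hx : x ∉ tsupport f) : lapl n f x = 0 := by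
  refine Finset.sum_eq_zero fun i _ => ?_
  rw [fderiv_of_notMem_tsupport, zero_apply]
  exact fun h => hx (tsupport_fderiv_apply_subset ℝ _ h)

/-- At a maximum of a mollification of `g` minus a quadratic, the Laplacian of the mollification
is at most that of the quadratic. -/
theorem integral_mul_lapl_le_of_isLocalMax {n : ℕ} {g f : EuclideanSpace ℝ (Fin n) → ℝ}
    (hg : Integrable g) (hf : ContDiff ℝ (⊤ : ℕ∞) f) (hfc : HasCompactSupport f)
    {a b : ℝ} {x z z' : EuclideanSpace ℝ (Fin n)}
    (hmax : IsLocalMax (fun x => (∫ y, g y * f (y - x)) - (a * ‖x - z‖ ^ 2 + b * ‖x - z'‖ ^ 2))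
      x) :
    ∫ y, g y * lapl n f (y - x) ≤ 2 * n * (a + b) := by
  let e : Fin n → EuclideanSpace ℝ (Fin n) := fun i => EuclideanSpace.single i 1
  let D : Fin n → EuclideanSpace ℝ (Fin n) → ℝ := fun i y => fderiv ℝ f y (e i)
  have hD : ∀ i, ContDiff ℝ (⊤ : ℕ∞) (D i) := fun i =>
    (hf.fderiv_right (by simp)).clm_apply contDiff_const
  have hDc : ∀ i, HasCompactSupport (D i) := fun i => hfc.fderiv_apply ℝ (e i)
  have hDD : ∀ i, Continuous fun y => fderiv ℝ (D i) y (e i) := fun i =>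
    ((hD i).continuous_fderiv (by simp)).clm_apply continuous_const
  have hterm : ∀ i, ∫ y, g y * fderiv ℝ (D i) (y - x) (e i) ≤ 2 * (a + b) := by
    intro i
    have he : ‖e i‖ = 1 := by simp [e]
    have h₁ := fun t : ℝ => (hasDerivAt_integral_mul_comp_sub_line hg (hf.of_le (by simp)) hfc x
      (e i) t).sub (((hasDerivAt_norm_sub_sq_line x z (e i) t).const_mul a).add
        ((hasDerivAt_norm_sub_sq_line x z' (e i) t).const_mul b))
    have hlin : ∀ z : EuclideanSpace ℝ (Fin n), HasDerivAt
        (fun t : ℝ => 2 * inner ℝ (x - z) (e i) + 2 * t * ‖e i‖ ^ 2) 2 0 := by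
      intro z
      simpa [he] using (((hasDerivAt_id (0 : ℝ)).const_mul 2).const_add
        (2 * inner ℝ (x - z) (e i)))
    have h₂ := (hasDerivAt_integral_mul_comp_sub_line hg ((hD i).of_le (by simp)) (hDc i) x
      (e i) 0).neg.sub (((hlin z).const_mul a).add ((hlin z').const_mul b))
    have hcont : ContinuousAt (fun t : ℝ => x + t • e i) 0 := by fun_prop
    have hmax' := IsLocalMax.comp_continuous (g := fun t : ℝ => x + t • e i) (b := 0)
      (by simpa using hmax) hcont
    have := IsLocalMax.second_deriv_nonpos h₁ h₂ hmax'
    simp only [zero_smul, add_zero, neg_neg] at this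
    linarith
  calc ∫ y, g y * lapl n f (y - x)
      = ∑ i, ∫ y, g y * fderiv ℝ (D i) (y - x) (e i) := by
        rw [← integral_finsetSum]
        · simp only [lapl, Finset.mul_sum, D, e]
        · intro i _
          obtain ⟨C, hC⟩ := (hDD i).bounded_above_of_compact_support ((hDc i).fderiv_apply ℝ (e i))
          exact hg.mul_bdd (c := C)
            ((hDD i).comp (continuous_id.sub continuous_const)).aestronglyMeasurable
            (ae_of_all _ fun y => hC _)
    _ ≤ ∑ _i : Fin n, 2 * (a + b) := Finset.sum_le_sum fun i _ => hterm i
    _ = 2 * n * (a + b) := by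
        rw [Finset.sum_const, Finset.card_univ, Fintype.card_fin, nsmul_eq_mul]
        ring

/-- A continuous function with weak Laplacian at least `c` has no local maximum after subtracting
a paraboloid whose Laplacian is smaller than `c`. -/
theorem LapGeWeak.not_isLocalMax {n : ℕ} {V : Set (EuclideanSpace ℝ (Fin n))}
    {w : EuclideanSpace ℝ (Fin n) → ℝ} {a c : ℝ} (hV : IsOpen V) (hw : ContinuousOn w V)
    (hlap : LapGeWeak n V w c) (hac : 2 * n * a < c) {x₀ : EuclideanSpace ℝ (Fin n)} (hx₀ : x₀ ∈ V)
    (z : EuclideanSpace ℝ (Fin n)) :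
    ¬ IsLocalMax (fun x => w x - a * ‖x - z‖ ^ 2) x₀ := by
  intro hmax
  obtain ⟨b, hb, hab⟩ : ∃ b : ℝ, 0 < b ∧ 2 * n * (a + b) < c := by
    refine ⟨(c - 2 * n * a) / (2 * (n + 1)), div_pos (by linarith) (by positivity), ?_⟩
    have hn : (0 : ℝ) < n + 1 := by positivity
    have : 2 * n * (a + (c - 2 * n * a) / (2 * (n + 1))) =
        c - (c - 2 * n * a) / (n + 1) := by field_simp; ring
    rw [this]
    have := div_pos (sub_pos.2 hac) hn
    linarith
  obtain ⟨R, hR, hRV⟩ : ∃ R > 0, closedBall x₀ R ⊆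
      V ∩ {x | w x - a * ‖x - z‖ ^ 2 ≤ w x₀ - a * ‖x₀ - z‖ ^ 2} :=
    nhds_basis_closedBall.mem_iff.1 (inter_mem (hV.mem_nhds hx₀) hmax)
  have hwR : ContinuousOn w (closedBall x₀ R) := hw.mono fun x hx => (hRV hx).1
  have hK : IsCompact (closedBall x₀ R) := isCompact_closedBall _ _
  set κ : ℝ := b * R ^ 2 / 16 with hκ
  have hκ0 : 0 < κ := by positivity
  obtain ⟨ε, hε, hεw⟩ := Metric.uniformContinuousOn_iff.1
    (hK.uniformContinuousOn_of_continuous hwR) κ hκ0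
  set δ : ℝ := min ε (R / 2) with hδ
  have hδ0 : 0 < δ := lt_min hε (by positivity)
  let ψ : ContDiffBump (0 : EuclideanSpace ℝ (Fin n)) := ⟨δ / 2, δ, by positivity, by linarith⟩
  set ρ : EuclideanSpace ℝ (Fin n) → ℝ := ψ.normed volume with hρ
  have hρsmooth : ContDiff ℝ (⊤ : ℕ∞) ρ := ψ.contDiff_normed
  have hρc : HasCompactSupport ρ := ψ.hasCompactSupport_normed
  have hρt : tsupport ρ = closedBall 0 δ := ψ.tsupport_normed_eq
  set g := (closedBall x₀ R).indicator w with hgdef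
  have hg : Integrable g :=
    (integrable_indicator_iff measurableSet_closedBall).2 (hwR.integrableOn_compact hK)
  set F : EuclideanSpace ℝ (Fin n) → ℝ := fun x => ∫ y, g y * ρ (y - x) with hF
  have hFconv : F = convolution ρ g (ContinuousLinearMap.lsmul ℝ ℝ) volume := by
    funext x
    rw [convolution_lsmul_swap]
    refine integral_congr_ae (ae_of_all _ fun y => ?_)
    simp only [smul_eq_mul]
    rw [mul_comm, ← neg_sub x y, hρ, ψ.normed_neg]
  have hFw : ∀ x ∈ closedBall x₀ (R / 2), |F x - w x| ≤ κ := by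
    intro x hx
    have hxR : x ∈ closedBall x₀ R := closedBall_subset_closedBall (by linarith) hx
    have hgx : g x = w x := indicator_of_mem hxR _
    rw [hFconv, ← hgx, ← Real.dist_eq]
    refine ψ.dist_normed_convolution_le hg.aestronglyMeasurable fun y hy => ?_
    have hyx : dist y x < δ := hy
    have hyR : y ∈ closedBall x₀ R := by
      rw [mem_closedBall] at hx ⊢
      have := min_le_right ε (R / 2)
      linarith [dist_triangle y x x₀]
    rw [hgx, hgdef, indicator_of_mem hyR]
    exact (hεw y hyR x hxR (hyx.trans_le (min_le_left _ _))).le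
  set G : EuclideanSpace ℝ (Fin n) → ℝ :=
    fun x => F x - (a * ‖x - z‖ ^ 2 + b * ‖x - x₀‖ ^ 2) with hG
  have hx₀R : x₀ ∈ closedBall x₀ (R / 2) := mem_closedBall_self (by positivity)
  have hFcont : Continuous F := by
    rw [hFconv]
    exact hρc.continuous_convolution_left _ hρsmooth.continuous hg.locallyIntegrable
  have hGcont : Continuous G := by fun_prop
  obtain ⟨x₁, hx₁, hx₁max⟩ := (isCompact_closedBall x₀ (R / 2)).exists_isMaxOn ⟨x₀, hx₀R⟩
    hGcont.continuousOn
  have hx₁lt : x₁ ∈ ball x₀ (R / 2) := by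
    by_contra hnot
    have hd : ‖x₁ - x₀‖ = R / 2 := by
      rw [← dist_eq_norm]
      exact le_antisymm hx₁ (not_lt.1 hnot)
    have h₁ : G x₀ ≤ G x₁ := hx₁max hx₀R
    have h₂ := abs_le.1 (hFw x₀ hx₀R)
    have h₃ := abs_le.1 (hFw x₁ hx₁)
    have h₄ : w x₁ - a * ‖x₁ - z‖ ^ 2 ≤ w x₀ - a * ‖x₀ - z‖ ^ 2 :=
      (hRV (closedBall_subset_closedBall (by linarith) hx₁)).2
    simp only [hG, hd, sub_self, norm_zero] at h₁
    nlinarith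
  have hGmax : IsLocalMax G x₁ := by
    filter_upwards [isOpen_ball.mem_nhds hx₁lt] with x hx using hx₁max (ball_subset_closedBall hx)
  have hupper := integral_mul_lapl_le_of_isLocalMax hg hρsmooth hρc hGmax
  have hts : tsupport (fun y => ρ (y - x₁)) ⊆ closedBall x₁ δ := by
    refine closure_minimal (fun y hy => ?_) isClosed_closedBall
    have : y - x₁ ∈ tsupport ρ := subset_tsupport _ hy
    rwa [hρt, mem_closedBall_zero_iff, ← dist_eq_norm] at this
  have hball : closedBall x₁ δ ⊆ closedBall x₀ R := by
    refine closedBall_subset_closedBall' ?_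
    have := min_le_right ε (R / 2)
    have := mem_ball.1 hx₁lt
    linarith
  have hlower := hlap (fun y => ρ (y - x₁))
    (hρsmooth.comp (contDiff_id.sub contDiff_const))
    (HasCompactSupport.of_support_subset_isCompact (isCompact_closedBall x₁ δ)
      ((subset_tsupport _).trans hts))
    ((hts.trans hball).trans fun x hx => (hRV hx).1) fun x => ψ.nonneg_normed _
  have hone : ∫ y in V, ρ (y - x₁) = 1 := by
    rw [setIntegral_eq_integral_of_forall_compl_eq_zero, integral_sub_right_eq_self ρ x₁]
    · exact ψ.integral_normed
    · intro y hy
      exact image_eq_zero_of_notMem_tsupport (f := fun y => ρ (y - x₁))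
        fun h => hy (hRV (hball (hts h))).1
  have hint : ∫ y in V, w y * lapl n (fun y => ρ (y - x₁)) y =
      ∫ y, g y * lapl n ρ (y - x₁) := by
    rw [setIntegral_eq_integral_of_forall_compl_eq_zero]
    · refine integral_congr_ae (ae_of_all _ fun y => ?_)
      by_cases hy : y ∈ closedBall x₀ R
      · simp only [hgdef, indicator_of_mem hy, lapl_comp_sub]
      · have := lapl_eq_zero_of_notMem_tsupport fun h => hy (hball (hts h))
        simp only [← lapl_comp_sub, this, mul_zero]
    · intro y hy
      rw [lapl_eq_zero_of_notMem_tsupport fun h => hy (hRV (hball (hts h))).1, mul_zero]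
  rw [hone, mul_one, hint] at hlower
  linarith

/-- **Non-degeneracy (Lemma 3.3).**  Let `Λ ⊆ U` be relatively closed, `w` continuous
on `U` with `w ≥ -σ²` in `U`, `w ≤ 0` on `Λ` and `Δw ≥ λ` weakly in `U ∖ Λ`.  If
`dist(z, Λ) > (2n/λ)^{1/2} σ` and `cl(B_r(z)) ⊆ U`, then
`sup_{cl(B_r(z))} w ≥ (λ/(2n)) r² - σ²`. -/
theorem nondegeneracy (n : ℕ) (U : Set (EuclideanSpace ℝ (Fin n))) (hUo : IsOpen U)
    (lam σ : ℝ) (hlam : lam ∈ Set.Ioc (0:ℝ) 1) (hσ : 0 ≤ σ)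
    (Λ : Set (EuclideanSpace ℝ (Fin n))) (hΛU : Λ ⊆ U) (hΛcl : closure Λ ∩ U ⊆ Λ)
    (w : EuclideanSpace ℝ (Fin n) → ℝ) (hwc : ContinuousOn w U)
    (hwlb : ∀ x ∈ U, -σ ^ 2 ≤ w x) (hwΛ : ∀ x ∈ Λ, w x ≤ 0)
    (hwlap : LapGeWeak n (U \ Λ) w lam)
    (z : EuclideanSpace ℝ (Fin n)) (hz : z ∈ U)
    (hdist : ∀ y ∈ Λ, Real.sqrt (2 * n / lam) * σ < dist z y)
    (r : ℝ) (hr : 0 < r) (hball : closedBall z r ⊆ U) :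
    lam / (2 * n) * r ^ 2 - σ ^ 2 ≤ sSup (w '' closedBall z r) := by
  have hlam0 : 0 < lam := hlam.1
  have hbdd : BddAbove (w '' closedBall z r) :=
    ((isCompact_closedBall z r).image_of_continuousOn (hwc.mono hball)).bddAbove
  have hle : ∀ x ∈ closedBall z r, w x ≤ sSup (w '' closedBall z r) := fun x hx =>
    le_csSup hbdd (mem_image_of_mem w hx)
  have hzr : z ∈ closedBall z r := mem_closedBall_self hr.le
  set M := sSup (w '' closedBall z r) with hM
  have hMlb : -σ ^ 2 ≤ M := (hwlb z hz).trans (hle z hzr)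
  rcases Nat.eq_zero_or_pos n with hn | hn
  · subst hn
    simpa using hMlb
  have hn0 : (0 : ℝ) < n := Nat.cast_pos.2 hn
  by_contra! hlt
  have hV : IsOpen (U \ Λ) := by
    have : U \ Λ = U ∩ (closure Λ)ᶜ := by
      ext x
      exact ⟨fun h => ⟨h.1, fun hc => h.2 (hΛcl ⟨hc, h.1⟩)⟩,
        fun h => ⟨h.1, fun hc => h.2 (subset_closure hc)⟩⟩
    rw [this]
    exact hUo.inter isClosed_closure.isOpen_compl
  have hdist_sq : ∀ y ∈ Λ, σ ^ 2 / ‖y - z‖ ^ 2 < lam / (2 * n) ∧ 0 < ‖y - z‖ := by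
    intro y hy
    have h := hdist y hy
    rw [dist_comm, dist_eq_norm] at h
    have hpos : 0 < ‖y - z‖ := (by positivity : (0 : ℝ) ≤ √(2 * n / lam) * σ).trans_lt h
    have hsq := pow_lt_pow_left₀ h (by positivity) two_ne_zero
    rw [mul_pow, Real.sq_sqrt (by positivity), div_mul_eq_mul_div, div_lt_iff₀ hlam0] at hsq
    refine ⟨?_, hpos⟩
    rw [div_lt_div_iff₀ (by positivity) (by positivity)]
    linarith
  obtain ⟨s, hs, hs0, hsΛ⟩ : ∃ s < lam / (2 * n), 0 ≤ s ∧
      ∀ y ∈ Λ ∩ closedBall z r, σ ^ 2 ≤ s * ‖y - z‖ ^ 2 := by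
    rcases (Λ ∩ closedBall z r).eq_empty_or_nonempty with hempty | hne
    · exact ⟨0, by positivity, le_rfl, by simp [hempty]⟩
    · have hcomp : IsCompact (Λ ∩ closedBall z r) := by
        have : Λ ∩ closedBall z r = closure Λ ∩ closedBall z r :=
          (inter_subset_inter_left _ subset_closure).antisymm
            fun x hx => ⟨hΛcl ⟨hx.1, hball hx.2⟩, hx.2⟩
        rw [this]
        exact (isCompact_closedBall z r).inter_left isClosed_closure
      obtain ⟨y₀, hy₀, hmin⟩ := hcomp.exists_isMinOn hne
        (by fun_prop : Continuous fun y => ‖y - z‖).continuousOn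
      have h₀ := hdist_sq y₀ hy₀.1
      refine ⟨_, h₀.1, by positivity, fun y hy => ?_⟩
      have hy : ‖y₀ - z‖ ≤ ‖y - z‖ := hmin hy
      rw [div_mul_eq_mul_div, le_div_iff₀ (pow_pos h₀.2 2)]
      gcongr
  have hMr : (M + σ ^ 2) / r ^ 2 < lam / (2 * n) := by
    rw [div_lt_iff₀ (by positivity)]
    linarith
  obtain ⟨a, ha, hac⟩ := exists_between (max_lt hs hMr)
  have has : s < a := (le_max_left _ _).trans_lt ha
  have haM : M + σ ^ 2 < a * r ^ 2 :=
    (div_lt_iff₀ (by positivity)).1 ((le_max_right _ _).trans_lt ha)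
  have hac' : 2 * n * a < lam := by
    rw [lt_div_iff₀ (by positivity)] at hac
    linarith
  obtain ⟨x₀, hx₀, hmax⟩ := (isCompact_closedBall z r).exists_isMaxOn ⟨z, hzr⟩
    (f := fun x => w x - a * ‖x - z‖ ^ 2)
    ((hwc.mono hball).sub (by fun_prop : Continuous fun x => a * ‖x - z‖ ^ 2).continuousOn)
  have hlb : -σ ^ 2 ≤ w x₀ - a * ‖x₀ - z‖ ^ 2 := by
    have h : w z - a * ‖z - z‖ ^ 2 ≤ w x₀ - a * ‖x₀ - z‖ ^ 2 := hmax hzr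
    have := hwlb z hz
    simp only [sub_self, norm_zero] at h
    linarith
  have hx₀ball : x₀ ∈ ball z r := by
    by_contra hnot
    have hd : ‖x₀ - z‖ = r := by
      rw [← dist_eq_norm]
      exact le_antisymm hx₀ (not_lt.1 hnot)
    rw [hd] at hlb
    linarith [hle x₀ hx₀]
  have hx₀Λ : x₀ ∉ Λ := by
    intro hmem
    have h₁ := hsΛ x₀ ⟨hmem, hx₀⟩
    have h₂ := mul_lt_mul_of_pos_right has (pow_pos (hdist_sq x₀ hmem).2 2)
    linarith [hwΛ x₀ hmem]
  refine hwlap.not_isLocalMax hV (hwc.mono sdiff_subset) hac' ⟨hball hx₀, hx₀Λ⟩ z ?_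
  filter_upwards [isOpen_ball.mem_nhds hx₀ball] with x hx using hmax (ball_subset_closedBall hx)
end
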